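/- arXiv:2303.06130 — 2 statements merged into one kernel-verified Lean document; each statement's English description precedes it below -/
import Mathlib

section
/- Let v : [0,∞) → [0,∞) be differentiable and u : [0,∞) → [0,∞) be continuous, and let C > 0 and θ ∈ (0,1) be constants such that v′(t) ≤ −C v(t) + √(v(t)) · u(t) for all t ≥ 0. Then for all t ≥ 0, √(v(t)) ≤ √(v(0)) · e^{−C(1−θ)t/2} + (1/(Cθ)) · sup_{0 ≤ τ ≤ t} u(τ). -/
noncomputable section

/-- Comparison with the explicit supersolution `v 0 * exp (-C (1 - θ) t) + K ^ 2`, for a constant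
`K > 0` such that `u ≤ C θ K` on `[0, T]`. -/
theorem le_exp_add_sq_of_deriv_le {v u v' : ℝ → ℝ} {C θ K T : ℝ}
    (hC : 0 < C) (hθ₀ : 0 < θ) (hθ : θ < 1) (hK : 0 < K) (hv : ∀ t, 0 ≤ t → 0 ≤ v t)
    (hv' : ∀ t, 0 ≤ t → HasDerivWithinAt v (v' t) (Set.Ici 0) t)
    (hineq : ∀ t, 0 ≤ t → v' t ≤ -C * v t + Real.sqrt (v t) * u t)
    (huK : ∀ t ∈ Set.Icc 0 T, u t ≤ C * θ * K) :
    ∀ t ∈ Set.Icc 0 T, v t ≤ v 0 * Real.exp (-(C * (1 - θ) * t)) + K ^ 2 := by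
  have hB (x : ℝ) : HasDerivAt (fun t => v 0 * Real.exp (-(C * (1 - θ) * t)) + K ^ 2)
      (v 0 * (Real.exp (-(C * (1 - θ) * x)) * -(C * (1 - θ)))) x := by
    have h : HasDerivAt (fun t : ℝ => -(C * (1 - θ) * t)) (-(C * (1 - θ))) x := by
      simpa using ((hasDerivAt_id x).const_mul (C * (1 - θ))).fun_neg
    exact (h.exp.const_mul (v 0)).add_const (K ^ 2)
  refine image_le_of_deriv_right_lt_deriv_boundary' (f' := v')
    (fun x hx => (hv' x hx.1).continuousWithinAt.mono Set.Icc_subset_Ici_self)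
    (fun x hx => (hv' x hx.1).mono (Set.Ici_subset_Ici.2 hx.1)) ?_
    (fun x _ => (hB x).continuousAt.continuousWithinAt) (fun x _ => (hB x).hasDerivWithinAt) ?_
  · simpa using sq_nonneg K
  · intro x hx hvB
    have hE : 0 ≤ v 0 * Real.exp (-(C * (1 - θ) * x)) :=
      mul_nonneg (hv 0 le_rfl) (Real.exp_pos _).le
    have hKv : K ≤ Real.sqrt (v x) := Real.le_sqrt_of_sq_le (by linarith)
    have hsq : Real.sqrt (v x) * Real.sqrt (v x) = v x := Real.mul_self_sqrt (hv x hx.1)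
    have hux : u x ≤ C * θ * Real.sqrt (v x) :=
      (huK x ⟨hx.1, hx.2.le⟩).trans (by gcongr)
    have hsu : Real.sqrt (v x) * u x ≤ C * θ * v x := by
      calc Real.sqrt (v x) * u x ≤ Real.sqrt (v x) * (C * θ * Real.sqrt (v x)) := by gcongr
        _ = C * θ * v x := by rw [mul_left_comm, hsq]
    have hpos : 0 < C * (1 - θ) * K ^ 2 :=
      mul_pos (mul_pos hC (sub_pos.2 hθ)) (pow_pos hK 2)
    have hmul : C * (1 - θ) * v x =
        C * (1 - θ) * (v 0 * Real.exp (-(C * (1 - θ) * x)) + K ^ 2) := by rw [← hvB]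
    linarith [hineq x hx.1]

/-- **Lyapunov comparison lemma.** If `v ≥ 0` is differentiable, `u ≥ 0` is continuous,
and `v′ ≤ −C v + √v · u` on `[0,∞)` with `C > 0`, `θ ∈ (0,1)`, then
`√(v(t)) ≤ √(v(0)) e^{−C(1−θ)t/2} + (1/(Cθ)) sup_{0≤τ≤t} u(τ)` for all `t ≥ 0`. -/
theorem lyapunov_comparison
    (v u v' : ℝ → ℝ) (C θ : ℝ)
    (hC : 0 < C) (hθ : θ ∈ Set.Ioo (0:ℝ) 1)
    -- `v` maps into `[0,∞)` and is differentiable, `u` maps into `[0,∞)` and is continuous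
    (hvnn : ∀ t, 0 ≤ t → 0 ≤ v t)
    (hunn : ∀ t, 0 ≤ t → 0 ≤ u t)
    (hu : ContinuousOn u (Set.Ici 0))
    (hv' : ∀ t, 0 ≤ t → HasDerivWithinAt v (v' t) (Set.Ici 0) t)
    -- differential inequality `v′(t) ≤ −C v(t) + √(v(t)) u(t)`
    (hineq : ∀ t, 0 ≤ t → v' t ≤ -C * v t + Real.sqrt (v t) * u t) :
    ∀ t, 0 ≤ t →
      Real.sqrt (v t) ≤
        Real.sqrt (v 0) * Real.exp (-(C * (1 - θ) * t) / 2)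
        + (1 / (C * θ)) * sSup (u '' Set.Icc 0 t) := by
  intro T hT
  obtain ⟨hθ₀, hθ₁⟩ := hθ
  have hCθ : 0 < C * θ := mul_pos hC hθ₀
  have hbdd : BddAbove (u '' Set.Icc 0 T) :=
    (isCompact_Icc.image_of_continuousOn (hu.mono Set.Icc_subset_Ici_self)).bddAbove
  have huM : ∀ t ∈ Set.Icc 0 T, u t ≤ sSup (u '' Set.Icc 0 T) :=
    fun t ht => le_csSup hbdd (Set.mem_image_of_mem u ht)
  have hM : 0 ≤ sSup (u '' Set.Icc 0 T) := (hunn T hT).trans (huM T ⟨hT, le_rfl⟩)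
  refine le_of_forall_pos_le_add fun ε hε => ?_
  set K := 1 / (C * θ) * sSup (u '' Set.Icc 0 T) + ε with hKdef
  have hK : 0 < K := by positivity
  have huK : ∀ t ∈ Set.Icc 0 T, u t ≤ C * θ * K := by
    intro t ht
    have h : C * θ * K = sSup (u '' Set.Icc 0 T) + C * θ * ε := by
      rw [hKdef]; field_simp
    linarith [huM t ht, mul_pos hCθ hε]
  have hvT := le_exp_add_sq_of_deriv_le hC hθ₀ hθ₁ hK hvnn hv' hineq huK T ⟨hT, le_rfl⟩
  rw [add_assoc, ← hKdef]
  have hsq : Real.sqrt (v 0) ^ 2 = v 0 := Real.sq_sqrt (hvnn 0 le_rfl)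
  have hexp : Real.exp (-(C * (1 - θ) * T) / 2) ^ 2 = Real.exp (-(C * (1 - θ) * T)) := by
    rw [← Real.exp_nat_mul]; congr 1; push_cast; ring
  have hcross : 0 ≤ Real.sqrt (v 0) * Real.exp (-(C * (1 - θ) * T) / 2) * K := by positivity
  refine Real.sqrt_le_iff.2 ⟨by positivity, ?_⟩
  calc v T ≤ v 0 * Real.exp (-(C * (1 - θ) * T)) + K ^ 2 := hvT
    _ = (Real.sqrt (v 0) * Real.exp (-(C * (1 - θ) * T) / 2)) ^ 2 + K ^ 2 := by
      rw [mul_pow, hsq, hexp]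
    _ ≤ _ := by linarith [add_sq (Real.sqrt (v 0) * Real.exp (-(C * (1 - θ) * T) / 2)) K]

end
end

section
/- Let X be a real normed space, x : [0,∞) → X continuous, u : [0,∞) → [0,∞) continuous, V : [0,∞) → [0,∞) differentiable, and let a₁, a₂, w, ρ > 0 be constants such that a₁‖x(t)‖² ≤ V(t) ≤ a₂‖x(t)‖² for all t ≥ 0, and V′(t) ≤ −w‖x(t)‖² for every t with ‖x(t)‖ ≥ ρ u(t). Then for all t ≥ 0, ‖x(t)‖ ≤ √(a₂/a₁) · ‖x(0)‖ · e^{−(w/(2a₂)) t} + √(a₂/a₁) · ρ · sup_{0 ≤ τ ≤ t} u(τ). -/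
noncomputable section

/-- A function that decays at rate `l` whenever it is at least `c ≥ 0` exceeds its
exponentially decaying initial value by at most `c`. -/
theorem le_mul_exp_add_of_deriv_right_le {V V' : ℝ → ℝ} {l c t : ℝ} (hl : 0 < l) (hc : 0 ≤ c)
    (ht : 0 ≤ t) (hV : ContinuousOn V (Set.Icc 0 t))
    (hV' : ∀ s ∈ Set.Ico 0 t, HasDerivWithinAt V (V' s) (Set.Ici s) s) (hV0 : 0 ≤ V 0)
    (hdecr : ∀ s ∈ Set.Ico 0 t, c ≤ V s → V' s ≤ -l * V s) :
    V t ≤ V 0 * Real.exp (-l * t) + c := by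
  refine le_of_forall_pos_le_add fun ε hε => ?_
  have hB : ∀ s, HasDerivAt (fun s => V 0 * Real.exp (-l * s) + (c + ε))
      (V 0 * (Real.exp (-l * s) * (-l * 1))) s := fun s =>
    ((((hasDerivAt_id s).const_mul (-l)).exp).const_mul (V 0)).add_const _
  have key := image_le_of_deriv_right_lt_deriv_boundary hV hV'
    (B := fun s => V 0 * Real.exp (-l * s) + (c + ε)) (by simp; positivity) hB
    (fun s hs heq => by
      have h0 : 0 ≤ V 0 * Real.exp (-l * s) := by positivity
      have h1 := hdecr s hs (by rw [heq]; linarith)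
      rw [heq] at h1
      have h2 : 0 < l * (c + ε) := by positivity
      linarith) (Set.right_mem_Icc.2 ht)
  simpa only [add_assoc] using key

/-- **ISS Lyapunov estimate with quadratic comparison functions and linear gain.**
If `a₁‖x(t)‖² ≤ V(t) ≤ a₂‖x(t)‖²` and `V′(t) ≤ −w‖x(t)‖²` whenever `‖x(t)‖ ≥ ρ u(t)`,
then `‖x(t)‖ ≤ √(a₂/a₁) ‖x(0)‖ e^{−(w/(2a₂))t} + √(a₂/a₁) ρ sup_{0≤τ≤t} u(τ)`. -/
theorem iss_lyapunov_quadratic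
    {X : Type*} [NormedAddCommGroup X] [NormedSpace ℝ X]
    (x : ℝ → X) (u : ℝ → ℝ) (V V' : ℝ → ℝ)
    (a₁ a₂ w ρ : ℝ) (ha₁ : 0 < a₁) (ha₂ : 0 < a₂) (hw : 0 < w) (hρ : 0 < ρ)
    -- `x` is continuous, `u` is continuous and nonnegative on `[0,∞)`
    (hx : ContinuousOn x (Set.Ici 0))
    (hu : ContinuousOn u (Set.Ici 0))
    (hunn : ∀ t, 0 ≤ t → 0 ≤ u t)
    -- `V` maps into `[0,∞)` and is differentiable on `[0,∞)`
    (hVnn : ∀ t, 0 ≤ t → 0 ≤ V t)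
    (hV' : ∀ t, 0 ≤ t → HasDerivWithinAt V (V' t) (Set.Ici 0) t)
    -- quadratic bounds `a₁‖x(t)‖² ≤ V(t) ≤ a₂‖x(t)‖²`
    (hlow : ∀ t, 0 ≤ t → a₁ * ‖x t‖ ^ 2 ≤ V t)
    (hhigh : ∀ t, 0 ≤ t → V t ≤ a₂ * ‖x t‖ ^ 2)
    -- decrease condition: `V′(t) ≤ −w‖x(t)‖²` whenever `‖x(t)‖ ≥ ρ u(t)`
    (hdecr : ∀ t, 0 ≤ t → ρ * u t ≤ ‖x t‖ → V' t ≤ -w * ‖x t‖ ^ 2) :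
    ∀ t, 0 ≤ t →
      ‖x t‖ ≤
        Real.sqrt (a₂ / a₁) * ‖x 0‖ * Real.exp (-(w / (2 * a₂)) * t)
        + Real.sqrt (a₂ / a₁) * ρ * sSup (u '' Set.Icc 0 t) := by
  intro t ht
  set S := sSup (u '' Set.Icc 0 t)
  have hbdd : BddAbove (u '' Set.Icc 0 t) :=
    (isCompact_Icc.image_of_continuousOn (hu.mono Set.Icc_subset_Ici_self)).bddAbove
  have huS : ∀ s ∈ Set.Icc 0 t, u s ≤ S := fun s hs => le_csSup hbdd ⟨s, hs, rfl⟩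
  have hS : 0 ≤ S := (hunn t ht).trans (huS t (Set.right_mem_Icc.2 ht))
  have hVt : V t ≤ V 0 * Real.exp (-(w / a₂) * t) + a₂ * (ρ * S) ^ 2 := by
    refine le_mul_exp_add_of_deriv_right_le (V' := V') (by positivity) (by positivity) ht
      (fun s hs => (hV' s hs.1).continuousWithinAt.mono Set.Icc_subset_Ici_self)
      (fun s hs => (hV' s hs.1).mono (Set.Ici_subset_Ici.2 hs.1)) (hVnn 0 le_rfl)
      fun s hs hcs => ?_
    have hxs : ρ * S ≤ ‖x s‖ :=
      le_of_pow_le_pow_left₀ two_ne_zero (norm_nonneg _)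
        (le_of_mul_le_mul_left (hcs.trans (hhigh s hs.1)) ha₂)
    refine (hdecr s hs.1 (le_trans ?_ hxs)).trans ?_
    · exact mul_le_mul_of_nonneg_left (huS s ⟨hs.1, hs.2.le⟩) hρ.le
    · have h := mul_le_mul_of_nonneg_left (hhigh s hs.1) (div_pos hw ha₂).le
      have h' : w / a₂ * (a₂ * ‖x s‖ ^ 2) = w * ‖x s‖ ^ 2 := by field_simp
      linarith
  set E := Real.exp (-(w / (2 * a₂)) * t) with hE
  have hE2 : Real.exp (-(w / a₂) * t) = E ^ 2 := by
    rw [hE, ← Real.exp_nat_mul]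
    congr 1
    push_cast
    field_simp
  have hE0 : 0 < E := Real.exp_pos _
  have hsq : a₁ * ‖x t‖ ^ 2 ≤ a₂ * (‖x 0‖ * E + ρ * S) ^ 2 := by
    have h1 : V 0 * E ^ 2 ≤ a₂ * ‖x 0‖ ^ 2 * E ^ 2 := by
      gcongr
      exact hhigh 0 le_rfl
    have h2 : 0 ≤ a₂ * ((‖x 0‖ * E) * (ρ * S)) := by positivity
    rw [hE2] at hVt
    linarith [hlow t ht]
  have hfin : ‖x t‖ ≤ Real.sqrt (a₂ / a₁) * (‖x 0‖ * E + ρ * S) := by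
    refine le_of_pow_le_pow_left₀ two_ne_zero (by positivity) ?_
    rw [mul_pow, Real.sq_sqrt (by positivity), div_mul_eq_mul_div, le_div_iff₀ ha₁]
    linarith
  linarith

end
end
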